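/- arXiv:math/0201292 — 3 statements merged into one kernel-verified Lean document; each statement's English description precedes it below -/
import Mathlib

section
/- Let m ≥ 2 and let π be an irreducible permutation of {1,…,m}. Then the permutation a(π) = π ∘ τ_{π⁻¹(m)}⁻¹ is again irreducible. -/
/-- The permutation `τ_k` of `{1,…,m}` (0-based model: `Fin m`): it fixes the first `k`
elements `1,…,k` (0-based indices `0,…,k-1`) and cyclically moves one step forward the
remaining elements, i.e. (1-based) `i ↦ i+1` for `k+1 ≤ i ≤ m-1` and `m ↦ k+1`. -/
def tau (m k : ℕ) : Equiv.Perm (Fin m) :=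
  if h : k ≤ m then
    (finSumFinEquiv.trans (finCongr (Nat.add_sub_cancel' h))).permCongr
      (Equiv.sumCongr (Equiv.refl (Fin k)) (finRotate (m - k)))
  else 1

/-- The last element of `Fin m`, i.e. the element `m` of `{1,…,m}`. -/
def mLast (m : ℕ) (h : 0 < m) : Fin m := ⟨m - 1, by omega⟩

/-- The Rauzy map `a(π) = π ∘ τ_{π⁻¹(m)}⁻¹`. -/
def rauzyA (m : ℕ) (h : 0 < m) (π : Equiv.Perm (Fin m)) : Equiv.Perm (Fin m) :=
  π * (tau m (((π.symm (mLast m h)) : ℕ) + 1))⁻¹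

/-- The Rauzy map `b(π) = τ_{π(m)} ∘ π`. -/
def rauzyB (m : ℕ) (h : 0 < m) (π : Equiv.Perm (Fin m)) : Equiv.Perm (Fin m) :=
  tau m (((π (mLast m h)) : ℕ) + 1) * π

/-- A permutation `π` of `{1,…,m}` is irreducible if there is no `k` with `1 ≤ k < m`
such that `π({1,…,k}) = {1,…,k}` (0-based: `π` maps `{0,…,k-1}` onto itself). -/
def IrreduciblePerm {m : ℕ} (π : Equiv.Perm (Fin m)) : Prop :=
  ¬ ∃ k : ℕ, 1 ≤ k ∧ k < m ∧ ⇑π '' {i : Fin m | (i : ℕ) < k} = {i : Fin m | (i : ℕ) < k}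

/-- The order-reversing permutation `π₀(i) = m + 1 - i` of `{1,…,m}`. -/
def rev (m : ℕ) : Equiv.Perm (Fin m) where
  toFun i := ⟨m - 1 - (i : ℕ), by have := i.isLt; omega⟩
  invFun i := ⟨m - 1 - (i : ℕ), by have := i.isLt; omega⟩
  left_inv i := by have := i.isLt; apply Fin.ext; simp; omega
  right_inv i := by have := i.isLt; apply Fin.ext; simp; omega

/-- `τ_k` fixes the first `k` elements. -/
theorem tau_apply_of_lt (m k : ℕ) (i : Fin m) (hi : (i : ℕ) < k) : tau m k i = i := by
  unfold tau
  split_ifs with h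
  · have hi' : (finSumFinEquiv.trans (finCongr (Nat.add_sub_cancel' h)))
        (Sum.inl ⟨(i : ℕ), hi⟩) = i := by
      apply Fin.ext
      simp
    rw [Equiv.permCongr_apply, (Equiv.symm_apply_eq _).2 hi'.symm]
    exact hi'
  · rfl

/-- For `m ≥ 2`, if `π` is an irreducible permutation of `{1,…,m}` then
`a(π) = π ∘ (τ_{π⁻¹(m)})⁻¹` is again irreducible. -/
theorem rauzyA_irreducible (m : ℕ) (hm : 2 ≤ m) (π : Equiv.Perm (Fin m))
    (hπ : IrreduciblePerm π) :
    IrreduciblePerm (rauzyA m (by omega) π) := by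
  rintro ⟨k, hk1, hkm, hk⟩
  have hfix : ∀ i : Fin m, (i : ℕ) ≤ (π.symm (mLast m (by omega)) : ℕ) →
      rauzyA m (by omega) π i = π i := by
    intro i hi
    unfold rauzyA
    rw [Equiv.Perm.mul_apply]
    congr 1
    rw [Equiv.Perm.inv_eq_iff_eq]
    exact (tau_apply_of_lt _ _ _ (by omega)).symm
  have hp : k ≤ (π.symm (mLast m (by omega)) : ℕ) := by
    by_contra! hlt
    have h1 : rauzyA m (by omega) π (π.symm (mLast m (by omega))) ∈ {i : Fin m | (i : ℕ) < k} := by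
      rw [← hk]
      exact Set.mem_image_of_mem _ hlt
    rw [hfix _ le_rfl, Equiv.apply_symm_apply] at h1
    simp only [mLast, Set.mem_setOf_eq] at h1
    omega
  refine hπ ⟨k, hk1, hkm, ?_⟩
  refine Eq.trans (Set.image_congr ?_) hk
  intro i hi
  have hi' : (i : ℕ) < k := hi
  exact (hfix i (by omega)).symm
end

section
/- (Rauzy) Let m ≥ 2 and let π be an irreducible permutation of {1,…,m}. Then the Rauzy class of π (the set of permutations obtainable from π by finitely many applications of the maps a and b) contains at least one permutation σ satisfying σ(m) = 1 and σ(1) = m. -/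
/-- A permutation `π` of `{1,…,m}` is degenerate if for some `1 ≤ j < m` (here `j` is the
1-based value `(j : ℕ)` of an element of `Fin m`) one of the following holds:
(i) `π(j) = m`, `π(j+1) = 1` and `π(1) = π(m) + 1`;
(ii) `π(j+1) = 1` and `π(1) = π(j) + 1`;
(iii) `π(j) = m` and `π(j+1) = π(m) + 1`.
In the 0-based model, the element `e ∈ {1,…,m}` corresponds to the value `e - 1` in `Fin m`,
and the 1-based position `p` corresponds to the index `p - 1`. -/
def Degenerate (m : ℕ) (h : 0 < m) (π : Equiv.Perm (Fin m)) : Prop :=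
  ∃ j : Fin m, 1 ≤ (j : ℕ) ∧
    ( (((π ⟨(j : ℕ) - 1, by have := j.isLt; omega⟩ : Fin m) : ℕ) = m - 1 ∧
       ((π j : Fin m) : ℕ) = 0 ∧
       ((π ⟨0, h⟩ : Fin m) : ℕ) = ((π ⟨m - 1, by omega⟩ : Fin m) : ℕ) + 1)
    ∨ (((π j : Fin m) : ℕ) = 0 ∧
       ((π ⟨0, h⟩ : Fin m) : ℕ) =
         ((π ⟨(j : ℕ) - 1, by have := j.isLt; omega⟩ : Fin m) : ℕ) + 1)
    ∨ ((((π ⟨(j : ℕ) - 1, by have := j.isLt; omega⟩ : Fin m) : ℕ) = m - 1 ∧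
       ((π j : Fin m) : ℕ) = ((π ⟨m - 1, by omega⟩ : Fin m) : ℕ) + 1)) )

/-- One step of the Rauzy dynamics: application of the map `a` or `b`. -/
def RauzyStep (m : ℕ) (h : 0 < m) (σ σ' : Equiv.Perm (Fin m)) : Prop :=
  σ' = rauzyA m h σ ∨ σ' = rauzyB m h σ

/-- The Rauzy class of `π`: all permutations obtainable from `π` by finitely many
applications of the maps `a` and `b`. -/
def RauzyClass (m : ℕ) (h : 0 < m) (π : Equiv.Perm (Fin m)) : Set (Equiv.Perm (Fin m)) :=
  {σ | Relation.ReflTransGen (RauzyStep m h) π σ}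

/-- One step of the extended Rauzy dynamics: application of `a`, `b`, or `Ad_{π₀}`. -/
def ExtRauzyStep (m : ℕ) (h : 0 < m) (σ σ' : Equiv.Perm (Fin m)) : Prop :=
  σ' = rauzyA m h σ ∨ σ' = rauzyB m h σ ∨ σ' = rev m * σ * rev m

/-- The extended Rauzy class of `π`: all permutations obtainable from `π` by finitely many
applications of the maps `a`, `b`, and `Ad_{π₀}`. -/
def ExtRauzyClass (m : ℕ) (h : 0 < m) (π : Equiv.Perm (Fin m)) :
    Set (Equiv.Perm (Fin m)) :=
  {σ | Relation.ReflTransGen (ExtRauzyStep m h) π σ}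


theorem tau_of_lt (m k : ℕ) (hk : k ≤ m) (i : Fin m) (h : (i : ℕ) < k) : tau m k i = i := by
  obtain ⟨d, rfl⟩ := Nat.exists_eq_add_of_le hk
  have hi : i = (finSumFinEquiv.trans (finCongr (Nat.add_sub_cancel' hk)))
      (Sum.inl ⟨i, h⟩) := by
    apply Fin.ext; simp
  unfold tau
  rw [dif_pos hk]
  conv_lhs => rw [hi]
  rw [Equiv.permCongr_apply, Equiv.symm_apply_apply]
  conv_rhs => rw [hi]
  rfl

theorem tau_of_ge (m k : ℕ) (hk : k ≤ m) (i j : Fin m) (h : k ≤ (i : ℕ))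
    (hj : (j : ℕ) = i + 1) : tau m k i = j := by
  have hjm := j.isLt
  have hi : i = (finSumFinEquiv.trans (finCongr (Nat.add_sub_cancel' hk)))
      (Sum.inr ⟨i - k, by omega⟩) := by
    apply Fin.ext; simp; omega
  unfold tau
  rw [dif_pos hk]
  conv_lhs => rw [hi]
  rw [Equiv.permCongr_apply, Equiv.symm_apply_apply]
  apply Fin.ext
  obtain ⟨n, hn⟩ : ∃ n, m - k = n + 1 := ⟨m - k - 1, by omega⟩
  have key : ∀ (N : ℕ) (x : Fin N), (x : ℕ) + 1 < N → (finRotate N x : ℕ) = x + 1 := by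
    intro N x hx
    cases N with
    | zero => exact x.elim0
    | succ N =>
      have := finRotate_of_lt (n := N) (k := (x : ℕ)) (by omega)
      exact congrArg Fin.val this
  have := key (m - k) ⟨i - k, by omega⟩ (by simp; omega)
  have e : ∀ y : Fin (m - k), ((finSumFinEquiv.trans (finCongr (Nat.add_sub_cancel' hk)))
      (Sum.inr y) : ℕ) = k + y := by
    intro y; simp
  refine (e (finRotate (m - k) ⟨i - k, by omega⟩)).trans ?_
  rw [this, hj]
  show k + (i - k + 1) = (i : ℕ) + 1
  omega

theorem irr_inv {m : ℕ} {π : Equiv.Perm (Fin m)} (h : IrreduciblePerm π) :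
    IrreduciblePerm π⁻¹ := by
  rintro ⟨k, h1, h2, h3⟩
  refine h ⟨k, h1, h2, ?_⟩
  conv_lhs => rw [← h3]
  rw [← Set.image_comp]
  convert Set.image_id _
  ext x; simp

theorem rauzyA_low {m : ℕ} (h : 0 < m) (π : Equiv.Perm (Fin m)) (i : Fin m)
    (hi : i ≤ π.symm (mLast m h)) : rauzyA m h π i = π i := by
  have hp := (π.symm (mLast m h)).isLt
  have := tau_of_lt m ((π.symm (mLast m h) : ℕ) + 1) hp i (Nat.lt_succ_of_le hi)
  unfold rauzyA
  rw [Equiv.Perm.mul_apply]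
  congr 1
  rw [Equiv.Perm.inv_eq_iff_eq]
  exact this.symm

theorem rauzyA_high {m : ℕ} (h : 0 < m) (π : Equiv.Perm (Fin m)) (i j : Fin m)
    (hi : π.symm (mLast m h) < i) (hj : (j : ℕ) = i + 1) : rauzyA m h π j = π i := by
  have hp := (π.symm (mLast m h)).isLt
  have := tau_of_ge m ((π.symm (mLast m h) : ℕ) + 1) hp i j hi hj
  unfold rauzyA
  rw [Equiv.Perm.mul_apply]
  congr 1
  rw [Equiv.Perm.inv_eq_iff_eq]
  exact this.symm

theorem rauzyA_symm {m : ℕ} (h : 0 < m) (π : Equiv.Perm (Fin m)) :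
    (rauzyA m h π).symm (mLast m h) = π.symm (mLast m h) := by
  rw [Equiv.symm_apply_eq, rauzyA_low h π _ le_rfl]
  simp

theorem rauzyA_irr {m : ℕ} (h : 0 < m) {π : Equiv.Perm (Fin m)} (hirr : IrreduciblePerm π) :
    IrreduciblePerm (rauzyA m h π) := by
  rintro ⟨k, h1, h2, h3⟩
  have hkp : k ≤ (π.symm (mLast m h) : ℕ) := by
    by_contra hc
    have hm : rauzyA m h π (π.symm (mLast m h)) ∈ {i : Fin m | (i : ℕ) < k} := by
      rw [← h3]
      exact Set.mem_image_of_mem _ (by simpa using hc)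
    rw [rauzyA_low h π _ le_rfl] at hm
    simp [mLast] at hm
    omega
  refine hirr ⟨k, h1, h2, ?_⟩
  conv_rhs => rw [← h3]
  apply Set.image_congr
  intro i hi
  rw [rauzyA_low h π i]
  simp at hi
  exact Fin.le_def.2 (by omega)

theorem rauzyA_inv {m : ℕ} (h : 0 < m) (π : Equiv.Perm (Fin m)) :
    (rauzyA m h π)⁻¹ = rauzyB m h π⁻¹ := by
  unfold rauzyA rauzyB
  rw [mul_inv_rev, inv_inv]
  rfl

theorem rauzyB_inv {m : ℕ} (h : 0 < m) (π : Equiv.Perm (Fin m)) :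
    (rauzyB m h π)⁻¹ = rauzyA m h π⁻¹ := by
  unfold rauzyA rauzyB
  rw [mul_inv_rev]
  rfl

theorem reach_inv {m : ℕ} (h : 0 < m) {π σ : Equiv.Perm (Fin m)}
    (hr : Relation.ReflTransGen (RauzyStep m h) π σ) :
    Relation.ReflTransGen (RauzyStep m h) π⁻¹ σ⁻¹ := by
  induction hr with
  | refl => exact .refl
  | tail _ hs ih =>
    refine ih.tail ?_
    rcases hs with rfl | rfl
    · exact Or.inr (rauzyA_inv h _)
    · exact Or.inl (rauzyB_inv h _)

theorem moveA {m : ℕ} (h : 0 < m) (n : ℕ) : ∀ (π : Equiv.Perm (Fin m)) (j : Fin m),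
    (j : ℕ) + n = m - 1 → π.symm (mLast m h) < j → IrreduciblePerm π →
    ∃ σ, Relation.ReflTransGen (RauzyStep m h) π σ ∧ IrreduciblePerm σ ∧
      σ.symm (mLast m h) = π.symm (mLast m h) ∧ σ (mLast m h) = π j := by
  induction n with
  | zero =>
    intro π j hj hp hirr
    refine ⟨π, .refl, hirr, rfl, ?_⟩
    congr 1
    exact Fin.ext (by simp [mLast]; omega)
  | succ n ih =>
    intro π j hj hp hirr
    obtain ⟨σ, h1, h2, h3, h4⟩ := ih (rauzyA m h π) ⟨j + 1, by omega⟩ (by simp; omega)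
      (by rw [rauzyA_symm]; exact hp.trans (Fin.lt_def.2 (by simp))) (rauzyA_irr h hirr)
    refine ⟨σ, .head (Or.inl rfl) h1, h2, h3.trans (rauzyA_symm h π), h4.trans ?_⟩
    exact rauzyA_high h π j _ hp rfl

theorem moveB {m : ℕ} (h : 0 < m) (π : Equiv.Perm (Fin m)) (v : Fin m)
    (hv : π (mLast m h) < v) (hirr : IrreduciblePerm π) :
    ∃ σ, Relation.ReflTransGen (RauzyStep m h) π σ ∧ IrreduciblePerm σ ∧
      σ.symm (mLast m h) = π.symm v ∧ σ (mLast m h) = π (mLast m h) := by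
  obtain ⟨σ, h1, h2, h3, h4⟩ := moveA h (m - 1 - v) π⁻¹ v (by omega) hv (irr_inv hirr)
  exact ⟨σ⁻¹, by simpa using reach_inv h h1, irr_inv h2, h4, h3⟩

theorem stuck {m : ℕ} (h : 0 < m) (π : Equiv.Perm (Fin m)) (hirr : IrreduciblePerm π)
    (H1 : ∀ j, π.symm (mLast m h) < j → π (mLast m h) ≤ π j)
    (H2 : ∀ v, π (mLast m h) < v → π.symm (mLast m h) ≤ π.symm v) :
    (π (mLast m h) : ℕ) = 0 ∧ (π.symm (mLast m h) : ℕ) = 0 := by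
  have hmax : ∀ x : Fin m, x ≤ mLast m h := fun x => Fin.le_def.2 (by simp [mLast]; omega)
  have him : π '' Set.Iio (π.symm (mLast m h)) = Set.Iio (π (mLast m h)) := by
    ext v
    constructor
    · rintro ⟨i, hi, rfl⟩
      simp only [Set.mem_Iio] at hi ⊢
      by_contra hc
      rcases (not_lt.1 hc).lt_or_eq with hlt | heq
      · have := H2 _ hlt
        simp at this
        exact absurd hi (not_lt.2 this)
      · have := π.injective heq
        exact absurd hi (not_lt.2 (this ▸ hmax _))
    · intro hv
      simp only [Set.mem_Iio] at hv
      refine ⟨π.symm v, ?_, by simp⟩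
      simp only [Set.mem_Iio]
      by_contra hc
      rcases (not_lt.1 hc).lt_or_eq with hlt | heq
      · have := H1 _ hlt
        simp at this
        exact absurd hv (not_lt.2 this)
      · have := π.symm.injective heq
        exact absurd hv (not_lt.2 (this ▸ hmax _))
  have hcard : (π.symm (mLast m h) : ℕ) = π (mLast m h) := by
    have := congrArg Set.ncard him
    rw [Set.ncard_image_of_injective _ π.injective] at this
    rw [← Finset.coe_Iio, ← Finset.coe_Iio, Set.ncard_coe_finset, Set.ncard_coe_finset] at this
    simpa using this
  by_cases h0 : (π.symm (mLast m h) : ℕ) = 0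
  · exact ⟨hcard ▸ h0, h0⟩
  · refine absurd ⟨π.symm (mLast m h), by omega, (π.symm (mLast m h)).isLt, ?_⟩ hirr
    have e : π.symm (mLast m h) = π (mLast m h) := Fin.ext hcard
    rw [← e] at him
    exact him

theorem main_aux {m : ℕ} (h : 0 < m) (n : ℕ) : ∀ π : Equiv.Perm (Fin m), IrreduciblePerm π →
    (π.symm (mLast m h) : ℕ) + π (mLast m h) = n →
    ∃ σ, Relation.ReflTransGen (RauzyStep m h) π σ ∧
      (σ (mLast m h) : ℕ) = 0 ∧ (σ.symm (mLast m h) : ℕ) = 0 := by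
  induction n using Nat.strong_induction_on with
  | _ n ih =>
    intro π hirr hn
    by_cases H1 : ∀ j, π.symm (mLast m h) < j → π (mLast m h) ≤ π j
    · by_cases H2 : ∀ v, π (mLast m h) < v → π.symm (mLast m h) ≤ π.symm v
      · exact ⟨π, .refl, stuck h π hirr H1 H2⟩
      · push Not at H2
        obtain ⟨v, hv, hlt⟩ := H2
        obtain ⟨σ, h1, h2, h3, h4⟩ := moveB h π v hv hirr
        obtain ⟨ρ, r1, r2⟩ := ih _ (by rw [h3, h4]; rw [Fin.lt_def] at hlt; omega) σ h2 rfl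
        exact ⟨ρ, h1.trans r1, r2⟩
    · push Not at H1
      obtain ⟨j, hj, hlt⟩ := H1
      obtain ⟨σ, h1, h2, h3, h4⟩ := moveA h (m - 1 - j) π j (by omega) hj hirr
      obtain ⟨ρ, r1, r2⟩ := ih _ (by rw [h3, h4]; rw [Fin.lt_def] at hlt; omega) σ h2 rfl
      exact ⟨ρ, h1.trans r1, r2⟩

/-- Rauzy: For `m ≥ 2`, the Rauzy class of any irreducible permutation `π` of
`{1,…,m}` contains at least one permutation `σ` with `σ(m) = 1` and `σ(1) = m`. -/
theorem rauzyClass_exists_standard (m : ℕ) (hm : 2 ≤ m) (π : Equiv.Perm (Fin m))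
    (hirr : IrreduciblePerm π) :
    ∃ σ ∈ RauzyClass m (by omega) π,
      ((σ (mLast m (by omega)) : Fin m) : ℕ) = 0 ∧
      ((σ ⟨0, by omega⟩ : Fin m) : ℕ) = m - 1 := by
  obtain ⟨σ, h1, h2, h3⟩ := main_aux (show 0 < m by omega) _ π hirr rfl
  refine ⟨σ, h1, h2, ?_⟩
  have : σ.symm (mLast m (by omega)) = ⟨0, by omega⟩ := Fin.ext h3
  rw [← this, Equiv.apply_symm_apply]
  rfl
end

section
/- Let m ≥ 4 and let π be an irreducible nondegenerate permutation of {1,…,m}. Then the extended Rauzy class of π contains at least one permutation σ with the following two properties: (1) σ(m) = 1 and σ(1) = m; (2) the permutation σ' of {1,…,m−2} defined by σ'(j−1) = σ(j) − 1 after renumbering (i.e., the restriction of σ to the ordered set {2,3,…,m−1}, which is a bijection of this set onto itself, renormalized to a permutation of {1,…,m−2}) is irreducible. -/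
namespace RZ

theorem tau_val (m k : ℕ) (hk : k ≤ m) (i : Fin m) :
    ((tau m k i : Fin m) : ℕ) =
      if (i : ℕ) < k then (i : ℕ) else if (i : ℕ) = m - 1 then k else (i : ℕ) + 1 := by
  obtain ⟨n, rfl⟩ := Nat.exists_eq_add_of_le hk
  unfold tau
  rw [dif_pos hk]
  obtain ⟨s, hs⟩ := (finSumFinEquiv.trans (finCongr (Nat.add_sub_cancel' hk))).surjective i
  rw [Equiv.permCongr_apply, ← hs, Equiv.symm_apply_apply]
  rcases s with s | s
  · have := s.isLt
    simp
  · have hs' := s.isLt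
    have e : k + n - k = n := by omega
    simp only [Equiv.sumCongr_apply, Sum.map_inr, Equiv.trans_apply, finSumFinEquiv_apply_right,
      finCongr_apply, Fin.val_cast, Fin.val_natAdd]
    rw [if_neg (by omega)]
    have : ∀ N (s : Fin N), ((finRotate N s : Fin N) : ℕ) = if (s : ℕ) = N - 1 then (0 : ℕ) else (s : ℕ) + 1 := by
      intro N s
      cases N with
      | zero => exact s.elim0
      | succ N =>
        split_ifs with h
        · have : s = Fin.last N := Fin.ext (by simpa using h)
          subst this; simp
        · rw [finRotate_apply, Fin.val_add_one_of_lt]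
          rw [Fin.lt_def]; simp; omega
    rw [this]
    split_ifs <;> omega

variable {α : Type*}

def Rep {m : ℕ} (t d : List α) (π : Equiv.Perm (Fin m)) : Prop :=
  t.length = m ∧ d.length = m ∧ d.Nodup ∧ ∀ i : Fin m, t[(i : ℕ)]? = d[((π i : Fin m) : ℕ)]?

theorem tau_list {m : ℕ} (P Q : List α) (l c : α) (h : (P ++ l :: (Q ++ [c])).length = m)
    (i : Fin m) :
    (P ++ l :: c :: Q)[((tau m (P.length + 1) i : Fin m) : ℕ)]? =
      (P ++ l :: (Q ++ [c]))[(i : ℕ)]? := by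
  have hi := i.isLt
  simp at h
  rw [tau_val _ _ (by omega)]
  split_ifs with h1 h2
  · grind
  · grind
  · grind

theorem Rep.symm_last {m : ℕ} (h0 : 0 < m) {P Q d' : List α} {l : α} {π : Equiv.Perm (Fin m)}
    (h : Rep (P ++ l :: Q) (d' ++ [l]) π) :
    ((π.symm (mLast m h0) : Fin m) : ℕ) = P.length := by
  obtain ⟨h1, h2, h3, h4⟩ := h
  simp at h1 h2
  have := h4 ⟨P.length, by omega⟩
  simp at this
  have hlt := (π ⟨P.length, by omega⟩).isLt
  have e : π ⟨P.length, by omega⟩ = mLast m h0 := by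
    apply Fin.ext
    have h5 : (d' ++ [l])[m-1]? = some l := by grind
    rw [← h5] at this
    have := (List.getElem?_inj (by simp; omega) h3).1 this
    simp [mLast, this]
  rw [← e]; simp

theorem Rep.last {m : ℕ} (h0 : 0 < m) {P Q t' : List α} {l : α} {π : Equiv.Perm (Fin m)}
    (h : Rep (t' ++ [l]) (P ++ l :: Q) π) :
    ((π (mLast m h0) : Fin m) : ℕ) = P.length := by
  obtain ⟨h1, h2, h3, h4⟩ := h
  simp at h1 h2
  have := h4 (mLast m h0)
  have h5 : (t' ++ [l])[((mLast m h0 : Fin m) : ℕ)]? = some l := by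
    simp [mLast]; grind
  have h6 : (P ++ l :: Q)[P.length]? = some l := by simp
  rw [h5, ← h6] at this
  exact ((List.getElem?_inj (by simp) h3).1 this).symm

theorem Rep.stepA {m : ℕ} (h0 : 0 < m) {P Q d' : List α} {l c : α} {π : Equiv.Perm (Fin m)}
    (h : Rep (P ++ l :: (Q ++ [c])) (d' ++ [l]) π) :
    Rep (P ++ l :: c :: Q) (d' ++ [l]) (rauzyA m h0 π) := by
  have e := h.symm_last h0
  obtain ⟨h1, h2, h3, h4⟩ := h
  refine ⟨by simp at h1 ⊢; omega, h2, h3, fun i => ?_⟩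
  obtain ⟨j, rfl⟩ := (tau m (P.length + 1)).surjective i
  rw [tau_list P Q l c h1, h4]
  unfold rauzyA
  rw [e]; simp

theorem Rep.stepB {m : ℕ} (h0 : 0 < m) {P Q t' : List α} {l c : α} {π : Equiv.Perm (Fin m)}
    (h : Rep (t' ++ [l]) (P ++ l :: (Q ++ [c])) π) :
    Rep (t' ++ [l]) (P ++ l :: c :: Q) (rauzyB m h0 π) := by
  have e := h.last h0
  obtain ⟨h1, h2, h3, h4⟩ := h
  refine ⟨h1, by simp at h2 ⊢; omega, ?_, fun i => ?_⟩
  · refine (List.Perm.nodup_iff ?_).1 h3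
    refine List.Perm.append_left _ (List.Perm.cons _ ?_)
    exact List.perm_append_singleton _ _
  · unfold rauzyB
    rw [e, Equiv.Perm.mul_apply, tau_list P Q l c h2, h4]

theorem Rep.stepRev {m : ℕ} {t d : List α} {π : Equiv.Perm (Fin m)}
    (h : Rep t d π) : Rep t.reverse d.reverse (rev m * π * rev m) := by
  obtain ⟨h1, h2, h3, h4⟩ := h
  refine ⟨by simpa, by simpa, by simpa, fun i => ?_⟩
  have hi := i.isLt
  rw [List.getElem?_reverse (by omega)]
  have := h4 (rev m i)
  have hl := (π (rev m i)).isLt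
  simp only [Equiv.Perm.mul_apply]
  have e : ((rev m (π (rev m i)) : Fin m) : ℕ) = m - 1 - (π (rev m i) : ℕ) := rfl
  rw [e, List.getElem?_reverse (by omega), h1, h2]
  have e2 : ((rev m i : Fin m) : ℕ) = m - 1 - i := rfl
  rw [e2] at this
  rw [this]
  congr 1; omega

def Rch {m : ℕ} (h0 : 0 < m) (π : Equiv.Perm (Fin m)) (t d : List α) : Prop :=
  ∃ σ ∈ ExtRauzyClass m h0 π, Rep t d σ

variable {m : ℕ} {h0 : 0 < m} {π : Equiv.Perm (Fin m)}

theorem Rch.rev {t d : List α} (h : Rch h0 π t d) : Rch h0 π t.reverse d.reverse := by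
  obtain ⟨σ, h1, h2⟩ := h
  exact ⟨_, Relation.ReflTransGen.tail h1 (Or.inr (Or.inr rfl)), h2.stepRev⟩

theorem Rch.rotA {P Q S d' : List α} {l : α} (h : Rch h0 π (P ++ l :: (Q ++ S)) (d' ++ [l])) :
    Rch h0 π (P ++ l :: (S ++ Q)) (d' ++ [l]) := by
  induction S using List.reverseRecOn generalizing Q with
  | nil => simpa using h
  | append_singleton S c ih =>
    obtain ⟨σ, h1, h2⟩ := h
    rw [← List.append_assoc] at h2
    have := ih (Q := c :: Q) ⟨_, Relation.ReflTransGen.tail h1 (Or.inl rfl), h2.stepA h0⟩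
    simpa using this

theorem Rch.rotB {P Q S t' : List α} {l : α} (h : Rch h0 π (t' ++ [l]) (P ++ l :: (Q ++ S))) :
    Rch h0 π (t' ++ [l]) (P ++ l :: (S ++ Q)) := by
  induction S using List.reverseRecOn generalizing Q with
  | nil => simpa using h
  | append_singleton S c ih =>
    obtain ⟨σ, h1, h2⟩ := h
    rw [← List.append_assoc] at h2
    have := ih (Q := c :: Q) ⟨_, Relation.ReflTransGen.tail h1 (Or.inr (Or.inl rfl)), h2.stepB h0⟩
    simpa using this

theorem Rch.rotLA {P Q S d' : List α} {l : α} (h : Rch h0 π ((Q ++ S) ++ l :: P) (l :: d')) :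
    Rch h0 π ((S ++ Q) ++ l :: P) (l :: d') := by
  have h1 := h.rev
  have h2 : Rch h0 π (P.reverse ++ l :: (S.reverse ++ Q.reverse)) (d'.reverse ++ [l]) := by
    simpa using h1
  simpa using h2.rotA.rev

theorem Rch.rotLB {P Q S d' : List α} {l : α} (h : Rch h0 π (l :: d') ((Q ++ S) ++ l :: P)) :
    Rch h0 π (l :: d') ((S ++ Q) ++ l :: P) := by
  have h1 := h.rev
  have h2 : Rch h0 π (d'.reverse ++ [l]) (P.reverse ++ l :: (S.reverse ++ Q.reverse)) := by
    simpa using h1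
  simpa using h2.rotB.rev

/-- The exchange move. -/
theorem Rch.move {o l x y : α} {q1 q2 p2 r1 r2 s : List α}
    (h : Rch h0 π (o :: (q1 ++ l :: (q2 ++ y :: (p2 ++ [x]))))
      (y :: (s ++ x :: (r1 ++ l :: (r2 ++ [o]))))) :
    Rch h0 π (l :: (q2 ++ o :: (q1 ++ y :: p2)) ++ [x])
      (x :: (r2 ++ o :: (r1 ++ y :: s)) ++ [l]) := by
  have h1 : Rch h0 π ((o :: (q1 ++ l :: (q2 ++ y :: p2))) ++ [x])
      ((y :: s) ++ x :: ((r1 ++ [l]) ++ (r2 ++ [o]))) := by simpa using h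
  have h2 := h1.rotB
  have h3 : Rch h0 π (((o :: q1) ++ (l :: q2)) ++ y :: (p2 ++ [x]))
    (y :: (s ++ x :: (r2 ++ [o] ++ (r1 ++ [l])))) := by simpa using h2
  have h4 := h3.rotLA
  have h5 : Rch h0 π (l :: (q2 ++ o :: q1 ++ y :: p2 ++ [x]))
    (((y :: s) ++ (x :: (r2 ++ [o] ++ r1))) ++ l :: []) := by simpa using h4
  have h6 := h5.rotLB
  simpa using h6

theorem Rep.nodup_t {t d : List α} (h : Rep t d π) : t.Nodup := by
  obtain ⟨h1, h2, h3, h4⟩ := h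
  rw [List.nodup_iff_injective_get]
  intro i j hij
  have hi := i.isLt
  have hj := j.isLt
  have e1 := h4 ⟨i, by omega⟩
  have e2 := h4 ⟨j, by omega⟩
  have e3 : t[(i : ℕ)]? = t[(j : ℕ)]? := by simpa using hij
  simp only at e1 e2
  rw [e1, e2] at e3
  have := (List.getElem?_inj (by rw [h2]; exact Fin.isLt _) h3).1 e3
  have := π.injective (Fin.ext this)
  exact Fin.ext (by simpa using this)

theorem Rep.mem_iff {t d : List α} (h : Rep t d π) (a : α) : a ∈ t ↔ a ∈ d := by
  obtain ⟨h1, h2, h3, h4⟩ := h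
  rw [List.mem_iff_getElem?, List.mem_iff_getElem?]
  constructor
  · rintro ⟨i, hi⟩
    have := (List.getElem?_eq_some_iff.1 hi).1
    exact ⟨_, (h4 ⟨i, by omega⟩).symm.trans hi⟩
  · rintro ⟨i, hi⟩
    have := (List.getElem?_eq_some_iff.1 hi).1
    refine ⟨(π.symm ⟨i, by omega⟩ : Fin m), ?_⟩
    rw [h4]; simpa using hi

theorem Rch.nodup_t {t d : List α} (h : Rch h0 π t d) : t.Nodup := by
  obtain ⟨σ, -, h⟩ := h; exact h.nodup_t

theorem Rch.nodup_d {t d : List α} (h : Rch h0 π t d) : d.Nodup := by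
  obtain ⟨σ, -, h⟩ := h; exact h.2.2.1

theorem Rch.mem_iff {t d : List α} (h : Rch h0 π t d) (a : α) : a ∈ t ↔ a ∈ d := by
  obtain ⟨σ, -, h⟩ := h; exact h.mem_iff a

theorem Rch.length {t d : List α} (h : Rch h0 π t d) : t.length = m ∧ d.length = m := by
  obtain ⟨σ, -, h⟩ := h; exact ⟨h.1, h.2.1⟩

def LIrr (A A' : List α) : Prop :=
  ∀ X Y X' Y', A = X ++ Y → A' = X' ++ Y' → (∀ a, a ∈ X ↔ a ∈ X') → X = [] ∨ Y = []

theorem pre_cases {X Y S R : List α} {p : α} (h : X ++ Y = S ++ p :: R) :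
    (∃ S2, S = X ++ S2) ∨ (∃ X2, X = S ++ p :: X2 ∧ R = X2 ++ Y) := by
  rcases List.append_eq_append_iff.1 h with ⟨a, h1, h2⟩ | ⟨a, h1, h2⟩
  · exact Or.inl ⟨a, h1⟩
  · cases a with
    | nil => exact Or.inl ⟨[], by simpa using h1.symm⟩
    | cons b a =>
      simp at h2
      obtain ⟨rfl, rfl⟩ := h2
      exact Or.inr ⟨a, h1, rfl⟩

/-- Rauzy lemma: a standard-like pair is reached. -/
theorem rauzy_aux (n : ℕ) : ∀ (t' e f : List α) (v : α), e.length = n →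
    Rch h0 π (t' ++ [v]) (e ++ v :: f) →
    LIrr (t' ++ [v]) (e ++ v :: f) →
    ∃ (x : α) (w w' : List α), Rch h0 π (x :: w) (w' ++ [x]):= by
  induction n using Nat.strong_induction_on with
  | _ n ih =>
    intro t' e f v hn hr hirr
    have hnt := hr.nodup_t
    have hnd := hr.nodup_d
    have hmem := hr.mem_iff
    by_cases he : e = []
    · subst he
      exact ⟨v, t'.reverse, f.reverse, by simpa using hr.rev⟩
    · classical
      by_cases hex : ∃ S U W p r, t' = S ++ p :: (U ++ r :: W) ∧ p ∈ f ∧ r ∈ e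
      · obtain ⟨S, U, W, p, r, ht, hp, hre⟩ := hex
        obtain ⟨f1, f2, rfl⟩ := List.append_of_mem hp
        obtain ⟨e1, e2, rfl⟩ := List.append_of_mem hre
        subst ht
        have h1 : Rch h0 π ((S ++ p :: (U ++ r :: W)) ++ [v])
            ((e1 ++ r :: e2) ++ v :: ((f1 ++ [p]) ++ f2)) := by simpa using hr
        have h2 := h1.rotB
        have h3 : Rch h0 π (S ++ p :: ((U ++ [r]) ++ (W ++ [v])))
            (((e1 ++ r :: e2) ++ v :: (f2 ++ f1)) ++ [p]) := by simpa using h2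
        have h4 := h3.rotA
        have h5 : Rch h0 π ((S ++ p :: (W ++ v :: U)) ++ [r])
            (e1 ++ r :: (e2 ++ v :: (f2 ++ (f1 ++ [p])))) := by simpa using h4
        refine ih e1.length (by simp at hn; omega) _ _ _ _ rfl h5 ?_
        · intro X Y X' Y' hX hX' hXX
          by_contra hcon
          push Not at hcon
          obtain ⟨hc1, hc2⟩ := hcon
          have hnt2 := h5.nodup_t
          have hnd2 := h5.nodup_d
          rcases pre_cases (hX.symm.trans (by simp : _ = S ++ p :: ((W ++ v :: U) ++ [r]))) with
            ⟨S2, rfl⟩ | ⟨X2, rfl, hR⟩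
          · have hv : v ∉ X := by
              intro hv
              exact (List.nodup_append.1 hnt).2.2 v (by simp [hv]) v (by simp) rfl
            rcases pre_cases (hX'.symm.trans
              (by simp : _ = (e1 ++ r :: e2) ++ v :: (f2 ++ (f1 ++ [p])))) with
              ⟨E2, hE⟩ | ⟨X2, rfl, hR⟩
            · rcases hirr X (S2 ++ p :: (U ++ r :: W) ++ [v]) X' (E2 ++ v :: (f1 ++ p :: f2))
                (by simp) (by rw [hE]; simp) hXX with h | h
              · exact hc1 h
              · simp at h
            · exact hv ((hXX v).2 (by simp))
          · have hp' : p ∈ X' := (hXX p).1 (by simp)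
            rcases pre_cases (hX'.symm.trans
              (by simp : _ = (e1 ++ r :: (e2 ++ v :: (f2 ++ f1))) ++ p :: [])) with
              ⟨E2, hE⟩ | ⟨X3, rfl, hR3⟩
            · have : p ∈ (e1 ++ r :: (e2 ++ v :: (f2 ++ f1))) := by rw [hE]; simp [hp']
              grind
            · obtain ⟨y, hy⟩ := List.exists_mem_of_ne_nil _ hc2
              have hY' : Y' = [] := by simp at hR3; exact hR3.2
              subst hY'
              rw [hX] at hnt2
              have h7 := (List.nodup_append.1 hnt2).2.2 y
              have h8 : y ∈ (S ++ p :: (W ++ v :: U)) ++ [r] := by rw [hX]; simp [hy]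
              have h9 := (hmem y).1 (by simp at h8 ⊢; grind)
              refine h7 ((hXX y).2 ?_) y hy rfl
              simp at hR3
              subst hR3
              simp at h9 ⊢
              grind
      · exfalso
        have hsplit := List.takeWhile_append_dropWhile (p := fun a => decide (a ∈ e)) (l := t')
        have htw : ∀ a ∈ t'.takeWhile (fun a => decide (a ∈ e)), a ∈ e := by
          intro a ha
          simpa using List.mem_takeWhile_imp ha
        have hdw : ∀ p Y, t'.dropWhile (fun a => decide (a ∈ e)) = p :: Y → p ∉ e := by
          intro p Y hpY hp
          have := List.head_dropWhile_not (fun a => decide (a ∈ e)) (l := t') (by rw [hpY]; simp)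
          simp [hpY] at this
          exact this hp
        generalize t'.takeWhile (fun a => decide (a ∈ e)) = X at *
        generalize t'.dropWhile (fun a => decide (a ∈ e)) = Y at *
        by_cases hsub : ∀ a ∈ e, a ∈ X
        · rcases hirr X (Y ++ [v]) e (v :: f) (by rw [← hsplit]; simp) rfl
            (fun a => ⟨htw a, hsub a⟩) with h | h
          · subst h
            apply he
            exact List.eq_nil_iff_forall_not_mem.2 (fun a ha => by simpa using hsub a ha)
          · simp at h
        · push Not at hsub
          obtain ⟨r, hr1, hr2⟩ := hsub
          have h1 := (hmem r).2 (by simp [hr1])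
          have hrv : r ≠ v := by rintro rfl; grind
          have h2 : r ∈ Y := by
            rw [← hsplit] at h1
            simp [hr2, hrv] at h1
            exact h1
          cases Y with
          | nil => simp at h2
          | cons p Y =>
            have hpe := hdw p Y rfl
            have hrY : r ∈ Y := by
              rcases List.mem_cons.1 h2 with h | h
              · exact absurd (h ▸ hr1) hpe
              · exact h
            obtain ⟨U, W, rfl⟩ := List.append_of_mem hrY
            have hpt : p ∈ t' := by rw [← hsplit]; simp
            have hpv : p ≠ v := by rintro rfl; grind
            have hpf : p ∈ f := by
              have := (hmem p).1 (by simp [hpt])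
              simp [hpe, hpv] at this
              exact this
            exact hex ⟨X, U, W, p, r, hsplit.symm, hpf, hr1⟩

theorem min_block (n : ℕ) : ∀ W W' : List α, W.length = n → W ≠ [] → (∀ a, a ∈ W ↔ a ∈ W') →
    ∃ A R A' R', W = A ++ R ∧ W' = A' ++ R' ∧ A ≠ [] ∧ (∀ a, a ∈ A ↔ a ∈ A') ∧ LIrr A A' := by
  induction n using Nat.strong_induction_on with
  | _ n ih =>
    intro W W' hn hW hmem
    by_cases h : LIrr W W'
    · exact ⟨W, [], W', [], by simp, by simp, hW, hmem, h⟩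
    · unfold LIrr at h
      push Not at h
      obtain ⟨X, Y, X', Y', rfl, rfl, h1, h2, h3⟩ := h
      have : 0 < Y.length := List.length_pos_iff.2 h3
      obtain ⟨A, R, A', R', rfl, rfl, h4, h5, h6⟩ := ih X.length (by simp at hn; omega) X X' rfl h2 h1
      exact ⟨A, R ++ Y, A', R' ++ Y', by simp, by simp, h4, h5, h6⟩

set_option maxHeartbeats 1000000 in
theorem main_aux (n : ℕ) : ∀ (o z : α) (A R A' R' : List α), R.length = n →
    Rch h0 π (o :: (A ++ R) ++ [z]) (z :: (A' ++ R') ++ [o]) → (∀ a, a ∈ A ↔ a ∈ A') →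
    LIrr A A' → A.head? ≠ A'.head? →
    ∃ (o z : α) (B B' : List α), Rch h0 π (o :: B ++ [z]) (z :: B' ++ [o]) ∧ LIrr B B' := by
  induction n using Nat.strong_induction_on with
  | _ n ih =>
    intro o z A R A' R' hn hr hmem hirr hhead
    have hnt := hr.nodup_t
    have hnd := hr.nodup_d
    have hall := hr.mem_iff
    cases R with
    | nil =>
      have : R' = [] := by
        refine List.eq_nil_iff_forall_not_mem.2 (fun a ha => ?_)
        have h1 := (hall a).2 (by simp [ha])
        have h2 := hmem a
        simp at h1 hnd hnt
        grind
      subst this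
      exact ⟨o, z, A, A', by simpa using hr, hirr⟩
    | cons x R2 =>
      have hx' : x ∈ R' := by
        have h1 := (hall x).1 (by simp)
        have h2 := hmem x
        simp at h1 hnt
        grind
      obtain ⟨R1', R2', rfl⟩ := List.append_of_mem hx'
      cases A with
      | nil =>
        have : A' = [] := List.eq_nil_iff_forall_not_mem.2 (fun a ha => by simpa using (hmem a).2 ha)
        subst this
        exact absurd rfl hhead
      | cons y A2 =>
        obtain ⟨A1', A2', rfl⟩ := List.append_of_mem ((hmem y).1 (by simp))
        have hA1 : A1' ≠ [] := by rintro rfl; simp at hhead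
        have h1 : Rch h0 π ([] ++ o :: ((y :: A2 ++ [x]) ++ (R2 ++ [z])))
          ((z :: (A1' ++ y :: (A2' ++ R1' ++ x :: R2'))) ++ [o]) := by simpa using hr
        have h2 := h1.rotA
        have h3 : Rch h0 π (o :: (R2 ++ z :: y :: (A2 ++ [x])))
          (((z :: A1') ++ (y :: (A2' ++ R1' ++ x :: R2'))) ++ o :: []) := by simpa using h2
        have h4 := h3.rotLB
        have h5 := Rch.move (h0 := h0) (π := π) (o := o) (l := z) (x := x) (y := y) (q1 := R2)
          (q2 := []) (p2 := A2) (r1 := R2') (r2 := A1') (s := A2' ++ R1') (by simpa using h4)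
        have hW : ∀ a, a ∈ ([] ++ o :: (R2 ++ y :: A2)) ↔
            a ∈ (A1' ++ o :: (R2' ++ y :: (A2' ++ R1'))) := by
          intro a
          have e1 := h5.mem_iff a
          have e2 := h5.nodup_t
          have e3 := h5.nodup_d
          simp at e1 e2 e3 ⊢
          grind
        have e2 := h5.nodup_t
        have e3 := h5.nodup_d
        obtain ⟨B, T, B', T', hB, hB', hBne, hBmem, hBirr⟩ := min_block _ _ _ rfl (by simp) hW
        have hoB : o ∈ B := by
          cases B with
          | nil => exact absurd rfl hBne
          | cons b B => simp at hB; simp [hB.1]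
        have hoA : o ∉ A1' := by simp at e3; grind
        have hA1B : ∀ a ∈ A1', a ∈ B := by
          intro a ha
          rw [hBmem]
          rcases pre_cases hB'.symm with ⟨S2, hS⟩ | ⟨X2, hX, -⟩
          · exact absurd (by rw [hS]; simp [(hBmem o).1 hoB]) hoA
          · rw [hX]; simp [ha]
        have hAB : ∀ a ∈ y :: A2, a ∈ B := by
          obtain ⟨c, hc⟩ := List.exists_mem_of_ne_nil _ hA1
          have hcB := hA1B c hc
          have hcA := (hmem c).2 (by simp [hc])
          rcases pre_cases (hB.symm.trans (by simp : _ = (o :: R2) ++ y :: A2)) with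
            ⟨S2, hS⟩ | ⟨X2, hX, hA2⟩
          · exfalso
            have : c ∈ o :: R2 := by rw [hS]; simp [hcB]
            have hcy : c ≠ y := by rintro rfl; simp at e3; grind
            simp at hcA this e2
            grind
          · have hyB : y ∈ B := by rw [hX]; simp
            have hyB' := (hBmem y).1 hyB
            have hB2 := hB'.symm.trans (by simp : _ = (A1' ++ o :: R2') ++ y :: (A2' ++ R1'))
            rcases pre_cases hB2 with
              ⟨S2, hS⟩ | ⟨X3, hX3, hA3⟩
            · exfalso
              have : y ∈ A1' ++ o :: R2' := by rw [hS]; simp [hyB']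
              simp [List.nodup_append] at this e3
              grind
            · rcases List.append_eq_append_iff.1 hA3 with ⟨C, hC1, hC2⟩ | ⟨C, hC1, hC2⟩
              · intro a ha
                rw [hBmem, hX3, hC1]
                have := (hmem a).1 ha
                simp at this ⊢
                grind
              · have key : ∀ a, a ∈ y :: X2 ↔ a ∈ A1' ++ y :: X3 := by
                  intro a
                  have k1 := hBmem a
                  have k2 := hmem a
                  have k3 : a ∈ y :: A2 → a ∉ o :: R2 := by
                    clear k1 k2 hX hX3 hA2 hC1 hC2 hA3 hB2
                    simp [List.nodup_append] at e2 ⊢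
                    grind
                  have k4 : a ∈ A1' ++ y :: A2' → a ∉ o :: R2' := by
                    clear k1 k2 hX hX3 hA2 hC1 hC2 hA3 hB2
                    simp [List.nodup_append] at e3 ⊢
                    grind
                  rw [hX, hX3] at k1
                  rw [hA2, hC1] at k2
                  rw [hA2] at k3
                  rw [hC1] at k4
                  clear * - k1 k2 k3 k4
                  simp only [List.mem_append, List.mem_cons] at k1 k2 k3 k4 ⊢
                  constructor
                  · intro h
                    have n1 := k4 (k2.1 (by rcases h with h | h <;> simp [h]))
                    have n2 := k1.1 (Or.inr h)
                    rcases n2 with (h | h) | h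
                    · exact Or.inl h
                    · exact absurd h n1
                    · exact Or.inr h
                  · intro h
                    have n1 := k3 (k2.2 (by rcases h with h | h | h <;> simp [h]))
                    have n2 := k1.2 (by rcases h with h | h | h <;> simp [h])
                    rcases n2 with h | h
                    · exact absurd h n1
                    · exact h
                rcases hirr (y :: X2) T (A1' ++ y :: X3) C (by rw [hA2]; simp)
                  (by rw [hC1]; simp) key with h | h
                · simp at h
                · subst h
                  intro a ha
                  rw [hX, List.mem_append]
                  right
                  simpa [hA2] using ha
        have hlen : (o :: y :: A2).length ≤ B.length := by
          apply List.Subperm.length_le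
          apply List.Nodup.subperm
          · simp at e2 ⊢; grind
          · intro a ha
            rcases List.mem_cons.1 ha with rfl | ha
            · exact hoB
            · exact hAB a ha
        have hlen2 := congrArg List.length hB
        simp at hlen hlen2 hn
        refine ih T.length (by omega) z x B T B' T' rfl ?_ hBmem hBirr ?_
        · rw [← hB, ← hB']; exact h5
        · intro hh
          cases B with
          | nil => exact hBne rfl
          | cons b B =>
            simp at hB
            cases B' with
            | nil => simp at hh
            | cons b' B' =>
              cases A1' with
              | nil => exact hA1 rfl
              | cons c A1' =>
                simp at hB' hh
                apply hoA
                simp [hB.1, hh, hB'.1]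

theorem first_diff : ∀ (w w' : List α), w.length = w'.length → w ≠ w' →
    ∃ c a b r r', w = c ++ a :: r ∧ w' = c ++ b :: r' ∧ a ≠ b
  | [], [], _, h => absurd rfl h
  | [], _ :: _, h, _ => by simp at h
  | _ :: _, [], h, _ => by simp at h
  | a :: w, b :: w', h, h' => by
    by_cases hab : a = b
    · subst hab
      obtain ⟨c, a', b', r, r', rfl, rfl, h3⟩ := first_diff w w' (by simpa using h)
        (fun e => h' (by rw [e]))
      exact ⟨a :: c, a', b', r, r', by simp, by simp, h3⟩
    · exact ⟨[], a, b, w, w', by simp, by simp, hab⟩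

theorem start_config (hm : 2 ≤ m) {x : α} {w w' : List α} (h : Rch h0 π (x :: w) (w' ++ [x])) :
    (∃ u v, v ≠ [] ∧ w = u ++ v ∧ w' = v ++ u) ∨
    ∃ (o z : α) (A R A' R' : List α),
      Rch h0 π (o :: (A ++ R) ++ [z]) (z :: (A' ++ R') ++ [o]) ∧ (∀ a, a ∈ A ↔ a ∈ A') ∧
      LIrr A A' ∧ A.head? ≠ A'.head? := by
  have hl := h.length
  have hnt := h.nodup_t
  cases w with
  | nil => simp at hl; omega
  | cons e w1 =>
    have he : e ∈ w' := by
      have := (h.mem_iff e).1 (by simp)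
      simp at this hnt
      grind
    obtain ⟨u', v', rfl⟩ := List.append_of_mem he
    by_cases heq : w1 = v' ++ u'
    · left
      by_cases hu : u' = []
      · exact ⟨[], e :: w1, by simp, by simp, by simp [heq, hu]⟩
      · exact ⟨e :: v', u', hu, by simp [heq], rfl⟩
    · right
      obtain ⟨c, a, b, r, r', h1, h2, hab⟩ := first_diff w1 (v' ++ u') (by simp at hl ⊢; omega) heq
      obtain ⟨g, z, hgz⟩ : ∃ g z, e :: c = g ++ [z] :=
        ⟨(e :: c).dropLast, (e :: c).getLast (by simp), (List.dropLast_append_getLast _).symm⟩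
      have h3 := h.rotLB
      have h4 : Rch h0 π ([] ++ x :: ((g ++ [z]) ++ a :: r)) ((g ++ z :: b :: r') ++ [x]) := by
        have e1 : x :: e :: w1 = [] ++ x :: ((g ++ [z]) ++ a :: r) := by
          rw [← hgz, h1]; simp
        have e2 : (e :: v') ++ u' ++ [x] = (g ++ z :: b :: r') ++ [x] := by
          have : g ++ z :: b :: r' = (g ++ [z]) ++ b :: r' := by simp
          rw [this, ← hgz, List.cons_append, h2]; simp
        rw [← e1, ← e2]; exact h3
      have h5 := h4.rotA
      have h6 : Rch h0 π (x :: ((a :: r ++ g) ++ [z])) ((g ++ z :: b :: r') ++ x :: []) := by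
        simpa using h5
      have h7 := h6.rotLB
      have hmem : ∀ y, y ∈ a :: r ++ g ↔ y ∈ b :: r' ++ g := by
        intro y
        have q1 := h7.mem_iff y
        have q2 := h7.nodup_t
        have q3 := h7.nodup_d
        simp [List.nodup_append] at q1 q2 q3 ⊢
        grind
      obtain ⟨A, R, A', R', hA, hA', hne, hAm, hirr⟩ := min_block _ _ _ rfl (by simp) hmem
      refine ⟨x, z, A, R, A', R', ?_, hAm, hirr, ?_⟩
      · rw [← hA, ← hA']; simpa using h7
      · cases A with
        | nil => exact absurd rfl hne
        | cons a1 A =>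
          cases A' with
          | nil => simp
          | cons b1 A' =>
            simp at hA hA' ⊢
            rw [← hA.1, ← hA'.1]; exact hab

/-- Permutations of rotation type. -/
def RotP (π : Equiv.Perm (Fin m)) : Prop :=
  ∃ A B C : List (Fin m), A ≠ [] ∧ C ≠ [] ∧ Rep (A ++ B ++ C) (C ++ B ++ A) π

theorem RotP.stepA (h : RotP π) : RotP (rauzyA m h0 π) := by
  obtain ⟨A, B, C, hA, hC, h⟩ := h
  obtain ⟨A, l, rfl⟩ := (List.eq_nil_or_concat' A).resolve_left hA
  obtain ⟨C, c, rfl⟩ := (List.eq_nil_or_concat' C).resolve_left hC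
  have h1 : Rep (A ++ l :: ((B ++ C) ++ [c])) ((C ++ [c] ++ B ++ A) ++ [l]) π := by
    simpa using h
  have h2 := h1.stepA h0
  by_cases hC' : C = []
  · subst hC'
    exact ⟨A ++ [l], [], c :: B, by simp, by simp, by simpa using h2⟩
  · exact ⟨A ++ [l], c :: B, C, by simp, hC', by simpa using h2⟩

theorem RotP.stepB (h : RotP π) : RotP (rauzyB m h0 π) := by
  obtain ⟨A, B, C, hA, hC, h⟩ := h
  obtain ⟨A, l, rfl⟩ := (List.eq_nil_or_concat' A).resolve_left hA
  obtain ⟨C, c, rfl⟩ := (List.eq_nil_or_concat' C).resolve_left hC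
  have h1 : Rep ((A ++ [l] ++ B ++ C) ++ [c]) (C ++ c :: ((B ++ A) ++ [l])) π := by
    simpa using h
  have h2 := h1.stepB h0
  by_cases hA' : A = []
  · subst hA'
    exact ⟨l :: B, [], C ++ [c], by simp, by simp, by simpa using h2⟩
  · exact ⟨A, l :: B, C ++ [c], hA', by simp, by simpa using h2⟩

theorem RotP.stepRev (h : RotP π) : RotP (_root_.rev m * π * _root_.rev m) := by
  obtain ⟨A, B, C, hA, hC, h⟩ := h
  exact ⟨C.reverse, B.reverse, A.reverse, by simpa, by simpa, by simpa using h.stepRev⟩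

theorem tau_fix (k : ℕ) (i : Fin m) (hi : (i : ℕ) + 1 = k) : tau m k i = i := by
  apply Fin.ext
  rw [tau_val _ _ (by omega), if_pos (by omega)]

theorem rauzyA_inj : Function.Injective (rauzyA m h0) := by
  have key : ∀ π : Equiv.Perm (Fin m), rauzyA m h0 π (π.symm (mLast m h0)) = mLast m h0 := by
    intro π
    unfold rauzyA
    rw [Equiv.Perm.mul_apply]
    have := tau_fix _ (π.symm (mLast m h0)) rfl
    rw [Equiv.Perm.inv_eq_iff_eq.2 this.symm]
    simp
  intro π ρ h
  have h1 := key π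
  rw [h] at h1
  have h1 := h1.trans (key ρ).symm
  have h2 := (rauzyA m h0 ρ).injective h1
  unfold rauzyA at h
  rw [h2] at h
  exact mul_right_cancel h

theorem rauzyB_inj : Function.Injective (rauzyB m h0) := by
  have key : ∀ π : Equiv.Perm (Fin m), rauzyB m h0 π (mLast m h0) = π (mLast m h0) := by
    intro π
    unfold rauzyB
    rw [Equiv.Perm.mul_apply]
    exact tau_fix _ _ rfl
  intro π ρ h
  have h1 := key π
  rw [h, key ρ] at h1
  unfold rauzyB at h
  rw [h1] at h
  exact mul_left_cancel h

theorem back {β : Type*} [Finite β] (f : β → β) (hf : Function.Injective f) (S : β → Prop)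
    (hS : ∀ x, S x → S (f x)) (x : β) (h : S (f x)) : S x := by
  have hfin : {x | S x}.Finite := Set.toFinite _
  have h2 : f '' {x | S x} = {x | S x} := by
    apply Set.eq_of_subset_of_ncard_le
    · rintro _ ⟨y, hy, rfl⟩; exact hS y hy
    · rw [Set.ncard_image_of_injective _ hf]
    · exact hfin
  obtain ⟨y, hy, hyx⟩ : f x ∈ f '' {x | S x} := by rw [h2]; exact h
  rw [← hf hyx]; exact hy

theorem RotP.of_reach {σ : Equiv.Perm (Fin m)} (hr : σ ∈ ExtRauzyClass m h0 π) (h : RotP σ) :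
    RotP π := by
  have hr' : Relation.ReflTransGen (ExtRauzyStep m h0) π σ := hr
  induction hr' using Relation.ReflTransGen.head_induction_on with
  | refl => exact h
  | head h1 h2 ih =>
    have ih := ih h2
    rcases h1 with rfl | rfl | rfl
    · exact back _ (rauzyA_inj (h0 := h0)) RotP (fun _ => RotP.stepA) _ ih
    · exact back _ (rauzyB_inj (h0 := h0)) RotP (fun _ => RotP.stepB) _ ih
    · refine back (fun π => _root_.rev m * π * _root_.rev m) ?_ RotP (fun _ => RotP.stepRev) _ ih
      intro a b hab
      exact mul_left_cancel (mul_right_cancel hab)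

theorem Rep.val {t d : List α} (h : Rep t d π) (i j : ℕ) (hi : i < m) (hj : j < m)
    (e : t[i]? = d[j]?) : ((π ⟨i, hi⟩ : Fin m) : ℕ) = j := by
  obtain ⟨h1, h2, h3, h4⟩ := h
  have := h4 ⟨i, hi⟩
  simp only at this
  rw [e] at this
  exact ((List.getElem?_inj (by omega) h3).1 this).symm

theorem RotP.degenerate (h : RotP π) : Degenerate m h0 π := by
  obtain ⟨A, B, C, hA, hC, h⟩ := h
  have hA' := List.length_pos_iff.2 hA
  have hC' := List.length_pos_iff.2 hC
  have hl := h.1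
  simp at hl
  by_cases hB : B = []
  · subst hB
    simp at hl
    refine ⟨⟨A.length, by omega⟩, hA', Or.inl ⟨?_, ?_, ?_⟩⟩
    · exact h.val _ _ _ (by omega) (by grind)
    · exact h.val _ _ _ (by omega) (by grind)
    · rw [h.val 0 C.length _ (by omega) (by grind), h.val (m - 1) (C.length - 1) _ (by omega) (by grind)]
      omega
  · have hB' := List.length_pos_iff.2 hB
    refine ⟨⟨A.length + B.length, by omega⟩, by simp; omega, Or.inr (Or.inl ⟨?_, ?_⟩)⟩
    · exact h.val _ _ _ (by omega) (by grind)
    · rw [h.val 0 (C.length + B.length) _ (by omega) (by grind),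
        h.val (A.length + B.length - 1) (C.length + B.length - 1) _ (by omega) (by grind)]
      omega

theorem initial : Rch h0 π (List.ofFn π) (List.finRange m) := by
  refine ⟨π, Relation.ReflTransGen.refl, by simp, by simp, List.nodup_finRange m, fun i => ?_⟩
  simp

theorem initial_irr (h : IrreduciblePerm π) : LIrr (List.ofFn π) (List.finRange m) := by
  intro X Y X' Y' h1 h2 h3
  by_contra hcon
  push Not at hcon
  have hX := List.length_pos_iff.2 hcon.1
  have hY := List.length_pos_iff.2 hcon.2
  have n1 : (X ++ Y).Nodup := by rw [← h1, List.nodup_ofFn]; exact π.injective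
  have n2 : (X' ++ Y').Nodup := by rw [← h2]; exact List.nodup_finRange m
  have hlen : X.length = X'.length :=
    ((List.perm_ext_iff_of_nodup (List.nodup_append.1 n1).1 (List.nodup_append.1 n2).1).2 h3).length_eq
  have hl := congrArg List.length h1
  simp at hl
  have memX : ∀ i : Fin m, π i ∈ X ↔ (i : ℕ) < X.length := by
    intro i
    have e : (X ++ Y)[(i : ℕ)]? = some (π i) := by rw [← h1]; simp
    constructor
    · intro hi
      obtain ⟨k, hk, hk'⟩ := List.getElem_of_mem hi
      have e2 : (X ++ Y)[k]? = some (π i) := by grind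
      rw [← e] at e2
      have := (List.getElem?_inj (by simp; omega) n1).1 e2
      omega
    · intro hi
      rw [List.getElem?_append_left hi] at e
      exact List.mem_of_getElem? e
  have memX' : ∀ i : Fin m, i ∈ X' ↔ (i : ℕ) < X'.length := by
    intro i
    have e : (X' ++ Y')[(i : ℕ)]? = some i := by rw [← h2]; simp
    constructor
    · intro hi
      obtain ⟨k, hk, hk'⟩ := List.getElem_of_mem hi
      have e2 : (X' ++ Y')[k]? = some i := by grind
      rw [← e] at e2
      have := (List.getElem?_inj (by simp; omega) n2).1 e2
      omega
    · intro hi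
      rw [List.getElem?_append_left hi] at e
      exact List.mem_of_getElem? e
  apply h
  refine ⟨X.length, hX, by omega, ?_⟩
  ext j
  obtain ⟨i, rfl⟩ := π.surjective j
  simp only [Set.mem_image, Set.mem_ofPred_eq, EmbeddingLike.apply_eq_iff_eq, exists_eq_right]
  rw [← memX, h3, memX', hlen]

theorem final (hm : 4 ≤ m) {o z : α} {B B' : List α} {σ : Equiv.Perm (Fin m)}
    (h : Rep (o :: B ++ [z]) (z :: B' ++ [o]) σ) (hirr : LIrr B B') :
      ((σ (mLast m h0) : Fin m) : ℕ) = 0 ∧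
      ((σ ⟨0, h0⟩ : Fin m) : ℕ) = m - 1 ∧
      ∃ σ' : Equiv.Perm (Fin (m - 2)),
        (∀ (i : Fin (m - 2)) (hi : (i : ℕ) + 1 < m),
          ((σ' i : Fin (m - 2)) : ℕ) = ((σ ⟨(i : ℕ) + 1, hi⟩ : Fin m) : ℕ) - 1) ∧
        IrreduciblePerm σ' := by
  have hl1 := h.1
  have hl2 := h.2.1
  simp at hl1 hl2
  have v1 : ((σ (mLast m (by omega)) : Fin m) : ℕ) = 0 := by
    exact h.val (m - 1) 0 _ (by omega) (by grind)
  have v2 : ((σ ⟨0, by omega⟩ : Fin m) : ℕ) = m - 1 := by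
    exact h.val _ _ _ (by omega) (by grind)
  have v3 : ∀ i : Fin m, 0 < (i : ℕ) → (i : ℕ) < m - 1 → 0 < (σ i : ℕ) ∧ (σ i : ℕ) < m - 1 := by
    intro i hi1 hi2
    have hlt := (σ i).isLt
    constructor
    · by_contra hc
      have : σ i = σ (mLast m (by omega)) := Fin.ext (by omega)
      have := congrArg Fin.val (σ.injective this)
      simp [mLast] at this; omega
    · by_contra hc
      have : σ i = σ ⟨0, by omega⟩ := Fin.ext (by omega)
      have := congrArg Fin.val (σ.injective this)
      simp at this; omega
  let f : Fin (m - 2) → Fin (m - 2) := fun i =>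
    ⟨((σ ⟨(i : ℕ) + 1, by have := i.isLt; omega⟩ : Fin m) : ℕ) - 1, by
      have hi := i.isLt
      have := v3 ⟨(i : ℕ) + 1, by omega⟩ (by simp) (by simp; omega)
      omega⟩
  have hf : Function.Injective f := by
    intro i j hij
    have hi := i.isLt
    have hj := j.isLt
    have e := congrArg Fin.val hij
    simp only [f] at e
    have q1 := v3 ⟨(i : ℕ) + 1, by omega⟩ (by simp) (by simp; omega)
    have q2 := v3 ⟨(j : ℕ) + 1, by omega⟩ (by simp) (by simp; omega)
    have := σ.injective (Fin.ext (by omega) : σ ⟨(i : ℕ) + 1, by omega⟩ = σ ⟨(j : ℕ) + 1, by omega⟩)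
    have := congrArg Fin.val this
    simp at this
    exact Fin.ext this
  refine ⟨v1, v2, Equiv.ofBijective f (Finite.injective_iff_bijective.1 hf), fun i _ => rfl, ?_⟩
  rintro ⟨k, hk1, hk2, him⟩
  have hBf : ∀ i : Fin (m - 2), B[(i : ℕ)]? = B'[(f i : ℕ)]? := by
    intro i
    have hi := i.isLt
    have q1 := v3 ⟨(i : ℕ) + 1, by omega⟩ (by simp) (by simp; omega)
    have q2 := h.2.2.2 ⟨(i : ℕ) + 1, by omega⟩
    simp only [f]
    generalize ((σ ⟨(i : ℕ) + 1, by omega⟩ : Fin m) : ℕ) = v at *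
    obtain ⟨v, rfl⟩ : ∃ v', v = v' + 1 := ⟨v - 1, by omega⟩
    simp only [List.cons_append, List.getElem?_cons_succ] at q2
    rw [List.getElem?_append_left (by omega), List.getElem?_append_left (by omega)] at q2
    simpa using q2
  have him' : ∀ j : Fin (m - 2), (j : ℕ) < k ↔ ∃ i : Fin (m - 2), (i : ℕ) < k ∧ f i = j := by
    intro j
    have := Set.ext_iff.1 him j
    simp at this
    exact this.symm
  rcases hirr (B.take k) (B.drop k) (B'.take k) (B'.drop k) (by simp) (by simp) (by
    intro a
    constructor
    · intro ha
      obtain ⟨i, hi⟩ := List.mem_iff_getElem?.1 ha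
      rw [List.getElem?_take] at hi
      split_ifs at hi with hik
      have hs := hBf ⟨i, by omega⟩
      simp only at hs
      rw [hs] at hi
      have := (him' (f ⟨i, by omega⟩)).2 ⟨_, hik, rfl⟩
      apply List.mem_iff_getElem?.2
      exact ⟨_, by rw [List.getElem?_take, if_pos this]; exact hi⟩
    · intro ha
      obtain ⟨j, hj⟩ := List.mem_iff_getElem?.1 ha
      rw [List.getElem?_take] at hj
      split_ifs at hj with hjk
      obtain ⟨i, hi, hij⟩ := (him' ⟨j, by omega⟩).1 hjk
      have hs := hBf i
      rw [hij] at hs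
      apply List.mem_iff_getElem?.2
      exact ⟨i, by rw [List.getElem?_take, if_pos hi, hs]; exact hj⟩) with h | h
  · have := congrArg List.length h
    rw [List.length_take, List.length_nil] at this; omega
  · have := congrArg List.length h
    simp at this; omega

theorem main (hm : 4 ≤ m) (hirr : IrreduciblePerm π) (hnd : ¬ Degenerate m h0 π) :
    ∃ (o z : Fin m) (B B' : List (Fin m)),
      Rch h0 π (o :: B ++ [z]) (z :: B' ++ [o]) ∧ LIrr B B' := by
  have hi := initial (h0 := h0) (π := π)
  have hI := initial_irr hirr
  have hmem := hi.mem_iff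
  have hlen := hi.length
  generalize List.ofFn π = t at *
  generalize List.finRange m = d at *
  obtain ⟨t, v, rfl⟩ := (List.eq_nil_or_concat' t).resolve_left (by rintro rfl; simp at hlen; omega)
  obtain ⟨e, f, rfl⟩ := List.append_of_mem ((hmem v).1 (by simp))
  obtain ⟨x, w, w', hx⟩ := rauzy_aux _ t e f v rfl hi hI
  rcases start_config (by omega) hx with ⟨u, v, hv, rfl, rfl⟩ | ⟨o, z, A, R, A', R', h1, h2, h3, h4⟩
  · exfalso
    apply hnd
    obtain ⟨σ, hσ, hrep⟩ := hx
    exact (RotP.of_reach hσ ⟨[x], u, v, by simp, hv, by simpa using hrep⟩).degenerate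
  · exact main_aux _ o z A R A' R' rfl h1 h2 h3 h4

end RZ

/-- For `m ≥ 4`, the extended Rauzy class of any irreducible nondegenerate
permutation `π` of `{1,…,m}` contains a permutation `σ` with `σ(m) = 1`, `σ(1) = m`, and
such that the restriction `σ'` of `σ` to the ordered set `{2,…,m-1}`, renumbered as a
permutation of `{1,…,m-2}` via `σ'(j-1) = σ(j) - 1`, is irreducible. (In the 0-based model:
`σ'` is the permutation of `Fin (m-2)` with `(σ' i : ℕ) = (σ ⟨i+1⟩ : ℕ) - 1`.) -/
theorem extRauzyClass_exists_standard_irreducible_restriction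
    (m : ℕ) (hm : 4 ≤ m) (π : Equiv.Perm (Fin m))
    (hirr : IrreduciblePerm π) (hnd : ¬ Degenerate m (by omega) π) :
    ∃ σ ∈ ExtRauzyClass m (by omega) π,
      ((σ (mLast m (by omega)) : Fin m) : ℕ) = 0 ∧
      ((σ ⟨0, by omega⟩ : Fin m) : ℕ) = m - 1 ∧
      ∃ σ' : Equiv.Perm (Fin (m - 2)),
        (∀ i : Fin (m - 2),
          ((σ' i : Fin (m - 2)) : ℕ)
            = ((σ ⟨(i : ℕ) + 1, by have := i.isLt; omega⟩ : Fin m) : ℕ) - 1) ∧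
        IrreduciblePerm σ' := by
  obtain ⟨o, z, B, B', ⟨σ, hσ, hrep⟩, hB⟩ := RZ.main (h0 := by omega) hm hirr hnd
  obtain ⟨h1, h2, σ', h3, h4⟩ := RZ.final (h0 := by omega) hm hrep hB
  exact ⟨σ, hσ, h1, h2, σ', fun i => h3 i _, h4⟩
end
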